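/- arXiv:1502.00126 — 2 statements merged into one kernel-verified Lean document; each statement's English description precedes it below -/
import Mathlib

section
/- Let X be an injective metric space, Y a metric space, ε > 0, and R ⊆ X × Y a surjective ε-approximation. If y_1, …, y_k ∈ Y and r_1, …, r_k ≥ 0 satisfy r_i + r_j ≥ d(y_i, y_j) for all i, j ∈ {1,…,k}, then there exists y ∈ Y with d(y, y_i) ≤ r_i + 2ε for all i. -/
/-- A metric space `X` is *injective* if for every pair of metric spaces `A`, `B`,
every isometric embedding `i : A → B` and every 1-Lipschitz map `f : A → X`,
there is a 1-Lipschitz map `F : B → X` with `F ∘ i = f`. -/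
def IsInjectiveMetricSpace (X : Type) [MetricSpace X] : Prop :=
  ∀ (A B : Type) [MetricSpace A] [MetricSpace B] (i : A → B) (f : A → X),
    Isometry i → LipschitzWith 1 f →
      ∃ F : B → X, LipschitzWith 1 F ∧ F ∘ i = f

/-- The one-point extension of a metric space `X` by a point at distance `g x` from each `x`,
where `g` is a positive Katětov function. -/
@[reducible] noncomputable def optionMetricSpace {X : Type} [MetricSpace X] (g : X → ℝ)
    (hpos : ∀ x, 0 < g x) (hlip : ∀ x x', g x ≤ g x' + dist x x')
    (hsum : ∀ x x', dist x x' ≤ g x + g x') : MetricSpace (Option X) where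
  dist
    | none, none => 0
    | none, some x => g x
    | some x, none => g x
    | some x, some x' => dist x x'
  dist_self := by rintro (_ | x) <;> simp
  dist_comm := by rintro (_ | x) (_ | x') <;> simp [dist_comm]
  dist_triangle := by
    rintro (_ | a) (_ | b) (_ | c)
    · simp
    · simp
    · simpa using (add_pos (hpos b) (hpos b)).le
    · have := hlip c b
      rw [dist_comm] at this
      exact this
    · simp
    · exact hsum a c
    · have := hlip a b
      rw [add_comm] at this
      exact this
    · exact dist_triangle a b c
  eq_of_dist_eq_zero := by
    rintro (_ | a) (_ | b) h
    · rfl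
    · exact absurd h (hpos b).ne'
    · exact absurd h (hpos a).ne'
    · exact congrArg some (eq_of_dist_eq_zero h)

theorem IsInjectiveMetricSpace.nonempty {X : Type} [MetricSpace X]
    (hX : IsInjectiveMetricSpace X) : Nonempty X := by
  obtain ⟨F, -, -⟩ := hX Empty Unit Empty.elim Empty.elim (fun a => a.elim) (fun a => a.elim)
  exact ⟨F ()⟩

theorem IsInjectiveMetricSpace.exists_dist_le_of_katetov {X : Type} [MetricSpace X]
    (hX : IsInjectiveMetricSpace X) (g : X → ℝ)
    (hpos : ∀ x, 0 < g x) (hlip : ∀ x x', g x ≤ g x' + dist x x')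
    (hsum : ∀ x x', dist x x' ≤ g x + g x') : ∃ z : X, ∀ x, dist z x ≤ g x := by
  let := optionMetricSpace g hpos hlip hsum
  obtain ⟨F, hF, hFi⟩ := hX X (Option X) some id
    (Isometry.of_dist_eq fun _ _ => rfl) LipschitzWith.id
  refine ⟨F none, fun x => ?_⟩
  have h := hF.dist_le_mul none (some x)
  rw [show F (some x) = x from congrFun hFi x, NNReal.coe_one, one_mul] at h
  exact h

/-- Injective metric spaces are hyperconvex, for finite families of balls of positive radius. -/
theorem IsInjectiveMetricSpace.exists_forall_dist_le {X ι : Type} [MetricSpace X] [Finite ι]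
    (hX : IsInjectiveMetricSpace X) (x : ι → X) (s : ι → ℝ) (hs : ∀ i, 0 < s i)
    (hxs : ∀ i j, dist (x i) (x j) ≤ s i + s j) : ∃ z : X, ∀ i, dist z (x i) ≤ s i := by
  cases isEmpty_or_nonempty ι
  · exact ⟨hX.nonempty.some, isEmptyElim⟩
  let g : X → ℝ := fun z => ⨅ i, (s i + dist z (x i))
  have hle (z : X) (i : ι) : g z ≤ s i + dist z (x i) :=
    ciInf_le (Set.finite_range _).bddBelow i
  have hattained (z : X) : ∃ i, s i + dist z (x i) = g z :=
    exists_eq_ciInf_of_finite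
  obtain ⟨z, hz⟩ := hX.exists_dist_le_of_katetov g
    (fun z => by
      obtain ⟨i, hi⟩ := hattained z
      rw [← hi]
      exact add_pos_of_pos_of_nonneg (hs i) dist_nonneg)
    (fun z z' => by
      obtain ⟨i, hi⟩ := hattained z'
      linarith [hle z i, dist_triangle z z' (x i)])
    (fun z z' => by
      obtain ⟨i, hi⟩ := hattained z
      obtain ⟨j, hj⟩ := hattained z'
      linarith [hxs i j, dist_triangle4 z (x i) (x j) z', dist_comm z' (x j)])
  refine ⟨z, fun i => (hz (x i)).trans ?_⟩
  simpa using hle (x i) i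

/-- If `X` is injective, `R ⊆ X × Y` is a surjective `ε`-approximation
(both projections are onto, and distances of related pairs differ by less than `ε`),
and the points `y 1, …, y k` and radii `r 1, …, r k ≥ 0` satisfy
`r i + r j ≥ d(y i, y j)`, then some `y' ∈ Y` satisfies `d(y', y i) ≤ r i + 2ε`
for all `i`. -/
theorem approx_hyperconvexity_transfer
    {X Y : Type} [MetricSpace X] [MetricSpace Y]
    (hX : IsInjectiveMetricSpace X)
    (ε : ℝ) (hε : 0 < ε) (R : Set (X × Y))
    (hprojX : ∀ x : X, ∃ y : Y, (x, y) ∈ R)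
    (hprojY : ∀ y : Y, ∃ x : X, (x, y) ∈ R)
    (happrox : ∀ p ∈ R, ∀ q ∈ R, |dist p.1 q.1 - dist p.2 q.2| < ε)
    (k : ℕ) (y : Fin k → Y) (r : Fin k → ℝ)
    (hr : ∀ i, 0 ≤ r i)
    (hrd : ∀ i j, dist (y i) (y j) ≤ r i + r j) :
    ∃ y' : Y, ∀ i, dist y' (y i) ≤ r i + 2 * ε := by
  choose x hx using fun i => hprojY (y i)
  obtain ⟨z, hz⟩ := hX.exists_forall_dist_le x (fun i => r i + ε / 2)
    (fun i => by linarith [hr i])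
    (fun i j => by linarith [(abs_lt.mp (happrox _ (hx i) _ (hx j))).2, hrd i j])
  obtain ⟨y', hy'⟩ := hprojX z
  exact ⟨y', fun i => by linarith [(abs_lt.mp (happrox _ hy' _ (hx i))).1, hz i]⟩
end

section
/- Let P be a finite poc set and let P° be its set of ultrafilters with the ℓ¹-distance. A subset H ⊆ P° is a half-space of the median metric space (P°, ℓ¹) if and only if H = V(a) := {U ∈ P° : a ∈ U} for some a ∈ P. Moreover, for all a, b ∈ P one has a < b if and only if V(a) ⊊ V(b). -/
/-- A *poc set*: a poset with least element `⊥` and an order-reversing involution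
`pstar` such that `a ≤ pstar a → a = ⊥`. -/
class PocSet (P : Type) extends PartialOrder P, OrderBot P where
  pstar : P → P
  pstar_pstar : ∀ a : P, pstar (pstar a) = a
  pstar_antitone : ∀ {a b : P}, a ≤ b → pstar b ≤ pstar a
  eq_bot_of_le_pstar : ∀ a : P, a ≤ pstar a → a = ⊥

namespace PocSet

variable {P : Type} [PocSet P]

/-- An *ultrafilter* on a poc set: a complete `⋆`-selection (for every `a`, exactly
one of `a`, `a⋆` belongs) which is coherent (no `a, b ∈ U` satisfy `a ≤ b⋆`). -/
def IsUltra (U : Set P) : Prop :=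
  (∀ a : P, a ∈ U ↔ pstar a ∉ U) ∧ ∀ a ∈ U, ∀ b ∈ U, ¬ a ≤ pstar b

/-- Two elements are *nested* if one of the four nesting relations holds. -/
def Nested (a b : P) : Prop :=
  a ≤ b ∨ a ≤ pstar b ∨ pstar a ≤ b ∨ pstar a ≤ pstar b

/-- A set is *nested* if its elements are pairwise nested. -/
def NestedSet (N : Set P) : Prop := ∀ a ∈ N, ∀ b ∈ N, Nested a b

/-- A set is *transverse* if no two distinct elements of it are nested. -/
def Transverse (A : Set P) : Prop := ∀ a ∈ A, ∀ b ∈ A, a ≠ b → ¬ Nested a b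

/-- The set of minimal elements of `V` (w.r.t. the order induced from `P`). -/
def minset (V : Set P) : Set P := {a ∈ V | ∀ b ∈ V, b ≤ a → b = a}

/-- An element is *proper* if it is neither `0` nor `0⋆`. -/
def IsProper (a : P) : Prop := a ≠ ⊥ ∧ a ≠ pstar (⊥ : P)

/-- `d∞(U,W)`: the maximum cardinality of a nested subset of `U \ W`. -/
noncomputable def dinfty (U W : Set P) : ℕ :=
  sSup {n : ℕ | ∃ N : Set P, N ⊆ U \ W ∧ NestedSet N ∧ N.ncard = n}

/-- The `ℓ¹`-distance between ultrafilters on a finite poc set: `|U \ W|`. -/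
noncomputable def ellone (U W : Set P) : ℕ := (U \ W).ncard

end PocSet

open PocSet

/-- The `ℓ¹`-interval between ultrafilters `U` and `V`: ultrafilters `Z` with
`ℓ¹(U,Z) + ℓ¹(Z,V) = ℓ¹(U,V)`. -/
def UltraInterval {P : Type} [PocSet P] (U V : Set P) : Set (Set P) :=
  {Z | IsUltra Z ∧ ellone U Z + ellone Z V = ellone U V}

/-- A set of ultrafilters is convex if it contains the `ℓ¹`-interval between any
two of its members. -/
def UltraConvex {P : Type} [PocSet P] (H : Set (Set P)) : Prop :=
  ∀ U ∈ H, ∀ V ∈ H, UltraInterval U V ⊆ H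

/-- A half-space of the median space `(P°, ℓ¹)` of ultrafilters: a set of
ultrafilters which is convex with convex complement (within `P°`). -/
def UltraHalfspace {P : Type} [PocSet P] (H : Set (Set P)) : Prop :=
  UltraConvex H ∧ UltraConvex ({U : Set P | IsUltra U} \ H)

namespace PocSet

variable {P : Type} [PocSet P]

lemma le_pstar_comm {a b : P} : a ≤ pstar b ↔ b ≤ pstar a := by
  constructor <;> intro h <;> simpa [pstar_pstar] using pstar_antitone h

lemma pstar_le_pstar_iff {a b : P} : pstar a ≤ pstar b ↔ b ≤ a := by
  rw [le_pstar_comm, pstar_pstar]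

/-- A set is coherent if no two of its elements satisfy `a ≤ b⋆`. -/
def Coherent (A : Set P) : Prop := ∀ a ∈ A, ∀ b ∈ A, ¬ a ≤ pstar b

lemma Coherent.bot_notMem {A : Set P} (hA : Coherent A) : ⊥ ∉ A :=
  fun h => hA _ h _ h bot_le

lemma Coherent.insert {A : Set P} {c : P} (hA : Coherent A) (hc : c ≠ ⊥)
    (h : ∀ a ∈ A, ¬ a ≤ pstar c) : Coherent (insert c A) := by
  rintro a (rfl | ha) b (rfl | hb)
  · exact fun h => hc (eq_bot_of_le_pstar _ h)
  · exact fun hab => h b hb (le_pstar_comm.1 hab)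
  · exact h a ha
  · exact hA a ha b hb

lemma coherent_pair {a b : P} (h : ¬ a ≤ b) : Coherent {a, pstar b} := by
  refine Coherent.insert ?_ (by rintro rfl; exact h bot_le) ?_
  · rintro x rfl y rfl hb
    have hbot := eq_bot_of_le_pstar _ hb
    exact h (pstar_le_pstar_iff.1 (hbot ▸ bot_le))
  · rintro x rfl hx
    exact h (pstar_le_pstar_iff.1 hx)

/-- In a finite poc set every nonempty coherent set extends to an ultrafilter. -/
lemma Coherent.exists_isUltra [Finite P] {A : Set P} (hA : Coherent A) (hne : A.Nonempty) :
    ∃ U, IsUltra U ∧ A ⊆ U := by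
  obtain ⟨U, hAU, hU⟩ := (Set.toFinite {B : Set P | Coherent B}).exists_le_maximal hA
  have hcoh : Coherent U := hU.prop
  obtain ⟨u, huA⟩ := hne
  have hu : u ∈ U := hAU huA
  have mem_of {c : P} (hc : c ≠ ⊥) (h : ∀ a ∈ U, ¬ a ≤ pstar c) : c ∈ U :=
    hU.le_of_ge (hcoh.insert hc h) (Set.subset_insert c U) (Set.mem_insert c U)
  have top_mem : pstar ⊥ ∈ U := by
    refine mem_of (fun h => hcoh u hu u hu ?_) fun a ha hab => ?_
    · have hu0 : u ≤ pstar ⊥ := le_pstar_comm.1 bot_le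
      rw [h, le_bot_iff] at hu0
      exact hu0 ▸ bot_le
    · rw [pstar_pstar, le_bot_iff] at hab
      exact hcoh.bot_notMem (hab ▸ ha)
  refine ⟨U, ⟨fun c => ⟨fun h h' => hcoh c h _ h' (pstar_pstar c).ge, fun h => ?_⟩, hcoh⟩, hAU⟩
  refine mem_of (by rintro rfl; exact h top_mem) fun a ha hac => h ?_
  refine mem_of ?_ fun b hb hbc => ?_
  · intro h0
    rw [h0, le_bot_iff] at hac
    exact hcoh.bot_notMem (hac ▸ ha)
  · rw [pstar_pstar] at hbc
    exact hcoh a ha b hb (hac.trans (pstar_antitone hbc))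

lemma IsUltra.mem_of_le {U : Set P} (hU : IsUltra U) {a b : P} (ha : a ∈ U) (h : a ≤ b) :
    b ∈ U :=
  (hU.1 b).2 fun hb => hU.2 a ha _ hb (by rwa [pstar_pstar])

lemma IsUltra.pstar_mem_iff {U : Set P} (hU : IsUltra U) {a : P} : pstar a ∈ U ↔ a ∉ U := by
  rw [hU.1 a, not_not]

lemma IsUltra.bot_notMem {U : Set P} (hU : IsUltra U) : ⊥ ∉ U :=
  Coherent.bot_notMem hU.2

lemma IsUltra.eq_of_subset {U W : Set P} (hU : IsUltra U) (hW : IsUltra W) (h : U ⊆ W) :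
    U = W :=
  h.antisymm fun x hx => by
    by_contra hxU
    exact hW.pstar_mem_iff.1 (h (hU.pstar_mem_iff.2 hxU)) hx

/-- Elements of a finite poc set are ordered as the sets of ultrafilters containing them. -/
lemma le_iff_forall_isUltra [Finite P] {a b : P} :
    a ≤ b ↔ ∀ U : Set P, IsUltra U → a ∈ U → b ∈ U := by
  refine ⟨fun h U hU ha => hU.mem_of_le ha h, fun h => ?_⟩
  by_contra hab
  obtain ⟨U, hU, hAU⟩ := (coherent_pair hab).exists_isUltra ⟨a, by simp⟩
  exact hU.pstar_mem_iff.1 (hAU (by simp)) (h U hU (hAU (by simp)))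

lemma mem_ultraInterval_iff [Finite P] {U V Z : Set P} (hU : IsUltra U) (hV : IsUltra V)
    (hZ : IsUltra Z) : Z ∈ UltraInterval U V ↔ U ∩ V ⊆ Z := by
  have hdisj : Disjoint (U \ Z) (Z \ V) :=
    Set.disjoint_left.2 fun x hx hx' => hx.2 hx'.1
  have hsub : U \ V ⊆ U \ Z ∪ Z \ V := fun x hx => by
    by_cases h : x ∈ Z
    exacts [Or.inr ⟨h, hx.2⟩, Or.inl ⟨hx.1, h⟩]
  simp only [UltraInterval, Set.mem_ofPred_eq, hZ, true_and, ellone,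
    ← Set.ncard_union_eq hdisj]
  constructor
  · rintro h x ⟨hxU, hxV⟩
    have heq := Set.eq_of_subset_of_ncard_le hsub h.le
    by_contra hx
    have : x ∈ U \ V := heq ▸ Or.inl ⟨hxU, hx⟩
    exact this.2 hxV
  · intro h
    congr 1
    refine Set.Subset.antisymm ?_ hsub
    rintro x (⟨hxU, hxZ⟩ | ⟨hxZ, hxV⟩)
    · exact ⟨hxU, fun hxV => hxZ (h ⟨hxU, hxV⟩)⟩
    · refine ⟨?_, hxV⟩
      by_contra hxU
      exact hZ.pstar_mem_iff.1 (h ⟨hU.pstar_mem_iff.2 hxU, hV.pstar_mem_iff.2 hxV⟩) hxZ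

/-- Replacing a minimal element of an ultrafilter by its complement gives an ultrafilter. -/
lemma IsUltra.flip {U : Set P} (hU : IsUltra U) {a : P} (ha : a ∈ minset U)
    (htop : pstar a ≠ ⊥) : IsUltra (insert (pstar a) (U \ {a})) := by
  have ne_pstar : pstar a ≠ a := fun h => hU.2 a ha.1 a ha.1 h.ge
  refine ⟨fun c => ?_, ?_⟩
  · have h1 : pstar c = pstar a ↔ c = a :=
      ⟨fun h => by rw [← pstar_pstar c, h, pstar_pstar], fun h => h ▸ rfl⟩
    have h2 : pstar c = a ↔ c = pstar a :=
      ⟨fun h => by rw [← h, pstar_pstar], fun h => by rw [h, pstar_pstar]⟩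
    have h3 : c = pstar a → c ≠ a := fun h h' => ne_pstar (h ▸ h')
    have h4 := hU.pstar_mem_iff (a := c)
    simp only [Set.mem_insert_iff, Set.mem_sdiff, Set.mem_singleton_iff, h1, h2, h4]
    tauto
  · refine Coherent.insert (fun x hx y hy => hU.2 x hx.1 y hy.1) htop ?_
    rintro x ⟨hxU, hxa⟩ hx
    rw [pstar_pstar] at hx
    exact hxa (ha.2 x hxU hx)

lemma ultraConvex_setOf_mem [Finite P] (a : P) :
    UltraConvex {U : Set P | IsUltra U ∧ a ∈ U} :=
  fun _ hU _ hV _ hZ =>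
    ⟨hZ.1, (mem_ultraInterval_iff hU.1 hV.1 hZ.1).1 hZ ⟨hU.2, hV.2⟩⟩

lemma ultraHalfspace_setOf_mem [Finite P] (a : P) :
    UltraHalfspace {U : Set P | IsUltra U ∧ a ∈ U} := by
  refine ⟨ultraConvex_setOf_mem a, ?_⟩
  convert ultraConvex_setOf_mem (pstar a) using 1
  ext U
  simp only [Set.mem_sdiff, Set.mem_ofPred_eq, not_and]
  exact ⟨fun h => ⟨h.1, h.1.pstar_mem_iff.2 (h.2 h.1)⟩,
    fun h => ⟨h.1, fun _ => h.1.pstar_mem_iff.1 h.2⟩⟩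

/-- Two ultrafilters on opposite sides of a partition, at minimal distance among such pairs,
differ in exactly one element. -/
lemma exists_sdiff_eq_singleton [Finite P] {H : Set (Set P)} {U W : Set P}
    (hU : IsUltra U) (hW : IsUltra W) (hUH : U ∈ H) (hWH : W ∉ H)
    (hmin : ∀ U' W' : Set P, IsUltra U' → IsUltra W' → U' ∈ H → W' ∉ H →
      ellone U W ≤ ellone U' W') :
    ∃ a, U \ W = {a} := by
  have hne : (U \ W).Nonempty := by
    rw [Set.sdiff_nonempty]
    exact fun h => hWH (hU.eq_of_subset hW h ▸ hUH)
  obtain ⟨a, ha⟩ := (Set.toFinite (U \ W)).exists_minimal hne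
  have haU : a ∈ minset U := by
    refine ⟨ha.prop.1, fun b hb hba => ?_⟩
    exact hba.antisymm (ha.le_of_le ⟨hb, fun h => ha.prop.2 (hW.mem_of_le h hba)⟩ hba)
  have haW : pstar a ∈ W := hW.pstar_mem_iff.2 ha.prop.2
  have hZ := hU.flip haU fun h => hW.bot_notMem (h ▸ haW)
  set Z := insert (pstar a) (U \ {a})
  have haZ : a ∉ Z := hZ.pstar_mem_iff.1 (Set.mem_insert _ _)
  have hsubZ : U ∩ W ⊆ Z := fun x hx =>
    Or.inr ⟨hx.1, fun h => ha.prop.2 (Set.mem_singleton_iff.1 h ▸ hx.2)⟩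
  have hdist := ((mem_ultraInterval_iff hU hW hZ).2 hsubZ).2
  have hUZ : U \ Z = {a} := by
    ext x
    constructor
    · rintro ⟨hxU, hxZ⟩
      by_contra hxa
      exact hxZ (Or.inr ⟨hxU, hxa⟩)
    · rintro rfl
      exact ⟨haU.1, haZ⟩
  have hone : ellone U Z = 1 := by rw [ellone, hUZ, Set.ncard_singleton]
  have hZH : Z ∉ H := fun h => by
    have := hmin Z W hZ hW h hWH
    omega
  have hle := hmin U Z hU hZ hUH hZH
  have hpos : 0 < ellone U W := (Set.ncard_pos (Set.toFinite _)).2 hne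
  exact Set.ncard_eq_one.1 (show ellone U W = 1 by omega)

end PocSet

lemma UltraHalfspace.exists_eq_setOf_mem {P : Type} [PocSet P] [Finite P]
    {H : Set (Set P)} (hHU : ∀ U ∈ H, IsUltra U) (hH : UltraHalfspace H) :
    ∃ a : P, H = {U : Set P | IsUltra U ∧ a ∈ U} := by
  rcases H.eq_empty_or_nonempty with rfl | ⟨U₀, hU₀⟩
  · exact ⟨⊥, (Set.eq_empty_of_forall_notMem fun U hU => hU.1.bot_notMem hU.2).symm⟩
  by_cases hall : ∀ U : Set P, IsUltra U → U ∈ H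
  · refine ⟨pstar ⊥, Set.ext fun U => ⟨fun h => ⟨hHU U h, ?_⟩, fun h => hall U h.1⟩⟩
    exact (hHU U h).pstar_mem_iff.2 (hHU U h).bot_notMem
  push Not at hall
  obtain ⟨W₀, hW₀, hW₀H⟩ := hall
  obtain ⟨⟨U, W⟩, ⟨hUH, hW, hWH⟩, hmin⟩ :=
    Set.exists_min_image {p : Set P × Set P | p.1 ∈ H ∧ IsUltra p.2 ∧ p.2 ∉ H}
      (fun p => ellone p.1 p.2) (Set.toFinite _) ⟨(U₀, W₀), hU₀, hW₀, hW₀H⟩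
  have hU := hHU U hUH
  obtain ⟨a, ha⟩ := exists_sdiff_eq_singleton hU hW hUH hWH
    fun U' W' _ hW' hU'H hW'H => hmin (U', W') ⟨hU'H, hW', hW'H⟩
  refine ⟨a, Set.ext fun T => ⟨fun hTH => ⟨hHU T hTH, ?_⟩, fun ⟨hT, haT⟩ => ?_⟩⟩
  · by_contra haT
    refine hWH (hH.1 U hUH T hTH ((mem_ultraInterval_iff hU (hHU T hTH) hW).2 ?_))
    rintro x ⟨hxU, hxT⟩
    by_contra hxW
    have : x ∈ ({a} : Set P) := ha ▸ ⟨hxU, hxW⟩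
    exact haT (Set.mem_singleton_iff.1 this ▸ hxT)
  · by_contra hTH
    refine (hH.2 W ⟨hW, hWH⟩ T ⟨hT, hTH⟩ ((mem_ultraInterval_iff hW hT hU).2 ?_)).2 hUH
    rintro x ⟨hxW, hxT⟩
    by_contra hxU
    have : pstar x ∈ ({a} : Set P) :=
      ha ▸ ⟨hU.pstar_mem_iff.2 hxU, fun h => hW.pstar_mem_iff.1 h hxW⟩
    exact hT.pstar_mem_iff.1 (Set.mem_singleton_iff.1 this ▸ haT) hxT

/-- For a finite poc set `P`, a set `H` of ultrafilters is a half-space of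
`(P°, ℓ¹)` iff `H = V(a) = {U ∈ P° | a ∈ U}` for some `a ∈ P`; moreover
`a < b ↔ V(a) ⊊ V(b)`. -/
theorem halfspaces_of_ultrafilter_space {P : Type} [PocSet P] [Finite P] :
    (∀ H : Set (Set P), (∀ U ∈ H, IsUltra U) →
      (UltraHalfspace H ↔ ∃ a : P, H = {U : Set P | IsUltra U ∧ a ∈ U})) ∧
    (∀ a b : P, a < b ↔
      {U : Set P | IsUltra U ∧ a ∈ U} ⊂ {U : Set P | IsUltra U ∧ b ∈ U}) := by
  have subset_iff (a b : P) : {U : Set P | IsUltra U ∧ a ∈ U} ⊆ {U | IsUltra U ∧ b ∈ U} ↔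
      a ≤ b :=
    ⟨fun h => le_iff_forall_isUltra.2 fun U hU ha => (h ⟨hU, ha⟩).2,
      fun h U hU => ⟨hU.1, hU.1.mem_of_le hU.2 h⟩⟩
  refine ⟨fun H hHU => ⟨fun hH => hH.exists_eq_setOf_mem hHU, ?_⟩, fun a b => ?_⟩
  · rintro ⟨a, rfl⟩
    exact ultraHalfspace_setOf_mem a
  · rw [lt_iff_le_not_ge, Set.ssubset_def, subset_iff, subset_iff]
end
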